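/- Let T > 0, let c : ℝ → ℝ be locally Lipschitz, and let κ : ℝ → ℝ be bounded (with bound M) and globally Lipschitz. Then for every continuous function w : [0,T] → ℝ there exists a unique continuous function x : [0,T] → ℝ satisfying x(t) = c( w(t) − ∫₀ᵗ κ(x(s)) ds ) for all t ∈ [0,T]. (The local Lipschitz hypothesis suffices because the argument w(t) − ∫₀ᵗ κ(x(s)) ds remains in the compact set of points of absolute value at most sup_{[0,T]}|w| + M·T.) -/

import Mathlib

open Set MeasureTheory

/-- A function that is Lipschitz on every compact subset of `ℝ` is continuous. -/
theorem continuous_of_lipschitzOnWith_isCompact {c : ℝ → ℝ}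
    (hc : ∀ K : Set ℝ, IsCompact K → ∃ L : NNReal, LipschitzOnWith L c K) : Continuous c := by
  refine continuous_iff_continuousAt.2 fun u ↦ ?_
  obtain ⟨L, hL⟩ := hc _ (isCompact_closedBall u 1)
  exact hL.continuousOn.continuousAt (Metric.closedBall_mem_nhds u one_pos)

/-- The vector field `z ↦ κ (c (w t - z))` is Lipschitz on closed balls, uniformly in `t`. -/
theorem exists_lipschitzOnWith_comp_sub {T R : ℝ} {c κ w : ℝ → ℝ} {Lκ : NNReal}
    (hc : ∀ K : Set ℝ, IsCompact K → ∃ L : NNReal, LipschitzOnWith L c K)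
    (hκ : LipschitzWith Lκ κ) (hw : ContinuousOn w (Icc 0 T)) :
    ∃ L : NNReal, ∀ t ∈ Icc (0 : ℝ) T,
      LipschitzOnWith L (fun z ↦ κ (c (w t - z))) (Metric.closedBall 0 R) := by
  obtain ⟨B, hB⟩ := isCompact_Icc.exists_bound_of_continuousOn hw
  obtain ⟨L, hL⟩ := hc _ (isCompact_closedBall 0 (B + R))
  refine ⟨Lκ * (L * 1), fun t ht ↦ hκ.comp_lipschitzOnWith (hL.comp ?_ fun z hz ↦ ?_)⟩
  · exact (LipschitzWith.of_dist_le_mul fun a b ↦ by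
      rw [dist_sub_left, NNReal.coe_one, one_mul]).lipschitzOnWith
  · rw [mem_closedBall_zero_iff] at hz ⊢
    exact (norm_sub_le _ _).trans (add_le_add (hB t ht) hz)

/-- The primitive of a continuous function on `[0, T]`, differentiated within `[0, T]`. -/
theorem hasDerivWithinAt_integral_Icc {T : ℝ} {g : ℝ → ℝ} (hg : ContinuousOn g (Icc 0 T))
    {t : ℝ} (ht : t ∈ Icc 0 T) :
    HasDerivWithinAt (fun r ↦ ∫ s in (0 : ℝ)..r, g s) (g t) (Icc 0 T) t := by
  have : Fact (t ∈ Icc 0 T) := ⟨ht⟩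
  refine intervalIntegral.integral_hasDerivWithinAt_right ?_
    (hg.stronglyMeasurableAtFilter_nhdsWithin measurableSet_Icc t) (hg t ht)
  exact (hg.mono (uIcc_subset_Icc ⟨le_rfl, ht.1.trans ht.2⟩ ht)).intervalIntegrable

/-- Continuous solutions of the Volterra equation are unique. -/
theorem volterra_eqOn {T : ℝ} {c κ w : ℝ → ℝ}
    (hc : ∀ K : Set ℝ, IsCompact K → ∃ L : NNReal, LipschitzOnWith L c K)
    {M : ℝ} (hκb : ∀ u : ℝ, |κ u| ≤ M) {Lκ : NNReal} (hκ : LipschitzWith Lκ κ)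
    (hw : ContinuousOn w (Icc 0 T)) {x y : ℝ → ℝ}
    (hx : ContinuousOn x (Icc 0 T))
    (hx' : ∀ t ∈ Icc (0 : ℝ) T, x t = c (w t - ∫ s in (0 : ℝ)..t, κ (x s)))
    (hy : ContinuousOn y (Icc 0 T))
    (hy' : ∀ t ∈ Icc (0 : ℝ) T, y t = c (w t - ∫ s in (0 : ℝ)..t, κ (y s))) :
    EqOn y x (Icc 0 T) := by
  obtain ⟨L, hL⟩ := exists_lipschitzOnWith_comp_sub (R := M * T) hc hκ hw
  have hderiv {z : ℝ → ℝ} (hz : ContinuousOn z (Icc 0 T))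
      (hz' : ∀ t ∈ Icc (0 : ℝ) T, z t = c (w t - ∫ s in (0 : ℝ)..t, κ (z s))) :
      ∀ t ∈ Icc (0 : ℝ) T, HasDerivWithinAt (fun r ↦ ∫ s in (0 : ℝ)..r, κ (z s))
        (κ (c (w t - ∫ s in (0 : ℝ)..t, κ (z s)))) (Icc 0 T) t := by
    intro t ht
    rw [← hz' t ht]
    exact hasDerivWithinAt_integral_Icc (hκ.continuous.comp_continuousOn hz) ht
  have hball (z : ℝ → ℝ) : ∀ t ∈ Ico (0 : ℝ) T,
      ∫ s in (0 : ℝ)..t, κ (z s) ∈ Metric.closedBall 0 (M * T) := by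
    intro t ht
    rw [mem_closedBall_zero_iff]
    refine (intervalIntegral.norm_integral_le_of_norm_le_const fun s _ ↦ hκb (z s)).trans ?_
    rw [sub_zero, abs_of_nonneg ht.1]
    exact mul_le_mul_of_nonneg_left ht.2.le ((abs_nonneg _).trans (hκb 0))
  have hright {z : ℝ → ℝ} {z' t : ℝ} (ht : t ∈ Ico 0 T)
      (h : HasDerivWithinAt z z' (Icc 0 T) t) : HasDerivWithinAt z z' (Ici t) t :=
    h.mono_of_mem_nhdsWithin (Icc_mem_nhdsGE_of_mem ht)
  have key := ODE_solution_unique_of_mem_Icc_right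
    (v := fun t z ↦ κ (c (w t - z))) (s := fun _ ↦ Metric.closedBall 0 (M * T))
    (fun t ht ↦ hL t (Ico_subset_Icc_self ht))
    (HasDerivWithinAt.continuousOn (hderiv hy hy'))
    (fun t ht ↦ hright ht (hderiv hy hy' t (Ico_subset_Icc_self ht))) (hball y)
    (HasDerivWithinAt.continuousOn (hderiv hx hx'))
    (fun t ht ↦ hright ht (hderiv hx hx' t (Ico_subset_Icc_self ht))) (hball x) (by simp)
  intro t ht
  rw [hy' t ht, hx' t ht]
  exact congrArg (fun z ↦ c (w t - z)) (key ht)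

/-- The Volterra equation has a continuous solution: `z t = ∫₀ᵗ κ (x s) ds` solves the ordinary
differential equation `z' = κ (c (w t - z))`, to which the Picard–Lindelöf theorem applies. -/
theorem exists_volterra_solution {T : ℝ} (hT : 0 ≤ T) {c κ w : ℝ → ℝ}
    (hc : ∀ K : Set ℝ, IsCompact K → ∃ L : NNReal, LipschitzOnWith L c K)
    {M : ℝ} (hκb : ∀ u : ℝ, |κ u| ≤ M) {Lκ : NNReal} (hκ : LipschitzWith Lκ κ)
    (hw : ContinuousOn w (Icc 0 T)) :
    ∃ x : ℝ → ℝ, ContinuousOn x (Icc 0 T) ∧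
      ∀ t ∈ Icc (0 : ℝ) T, x t = c (w t - ∫ s in (0 : ℝ)..t, κ (x s)) := by
  have hM : 0 ≤ M := (abs_nonneg _).trans (hκb 0)
  have hcc := continuous_of_lipschitzOnWith_isCompact hc
  have hκc := hκ.continuous
  obtain ⟨L, hL⟩ := exists_lipschitzOnWith_comp_sub (R := M * T) hc hκ hw
  have hPL : IsPicardLindelof (fun t z ↦ κ (c (w t - z)))
      (⟨0, le_rfl, hT⟩ : Icc (0 : ℝ) T) 0 ⟨M * T, mul_nonneg hM hT⟩ 0 ⟨M, hM⟩ L :=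
    { lipschitzOnWith := hL
      continuousOn := fun z _ ↦ by fun_prop
      norm_le := fun t _ z _ ↦ hκb _
      mul_max_le := by
        change M * max (T - 0) (0 - 0) ≤ M * T - 0
        simp [hT] }
  obtain ⟨z, hz0, hz⟩ := hPL.exists_eq_forall_mem_Icc_hasDerivWithinAt₀
  have hzc : ContinuousOn z (Icc 0 T) := HasDerivWithinAt.continuousOn hz
  refine ⟨fun t ↦ c (w t - z t), by fun_prop, fun t ht ↦ ?_⟩
  have hsub : uIcc 0 t ⊆ Icc 0 T := uIcc_subset_Icc ⟨le_rfl, hT⟩ ht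
  have hpic := ODE.picard_eq_of_hasDerivAt (f := fun t z ↦ κ (c (w t - z))) (u := univ)
    (hκc.comp_continuousOn <| hcc.comp_continuousOn <|
      ((hw.mono hsub).comp continuousOn_fst fun p hp ↦ hp.1).sub continuousOn_snd)
    (fun r hr ↦ (hz r (hsub hr)).mono hsub) (mapsTo_univ _ _)
  simp only [ODE.picard_apply] at hpic
  rw [show z 0 = 0 from hz0, zero_add] at hpic
  rw [hpic]

/-- Let `T > 0`, let `c : ℝ → ℝ` be locally Lipschitz (Lipschitz on every
compact subset of `ℝ`), and let `κ : ℝ → ℝ` be bounded (with bound `M`) and globally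
Lipschitz. Then for every continuous `w : [0,T] → ℝ` there is a unique continuous
`x : [0,T] → ℝ` with `x t = c (w t - ∫₀ᵗ κ (x s) ds)` for all `t ∈ [0,T]`. -/
theorem volterra_exists_unique_of_locallyLipschitz
    (T : ℝ) (hT : 0 < T) (c κ : ℝ → ℝ)
    (hc : ∀ K : Set ℝ, IsCompact K → ∃ L : NNReal, LipschitzOnWith L c K)
    (M : ℝ) (hκb : ∀ u : ℝ, |κ u| ≤ M)
    (Lκ : NNReal) (hκ : LipschitzWith Lκ κ)
    (w : ℝ → ℝ) (hw : ContinuousOn w (Icc 0 T)) :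
    ∃ x : ℝ → ℝ,
      (ContinuousOn x (Icc 0 T) ∧
        ∀ t ∈ Icc (0:ℝ) T, x t = c (w t - ∫ s in (0:ℝ)..t, κ (x s))) ∧
      ∀ y : ℝ → ℝ, ContinuousOn y (Icc 0 T) →
        (∀ t ∈ Icc (0:ℝ) T, y t = c (w t - ∫ s in (0:ℝ)..t, κ (y s))) →
        ∀ t ∈ Icc (0:ℝ) T, y t = x t := by
  obtain ⟨x, hx, hx'⟩ := exists_volterra_solution hT.le hc hκb hκ hw
  exact ⟨x, ⟨hx, hx'⟩, fun y hy hy' ↦ volterra_eqOn hc hκb hκ hw hx hx' hy hy'⟩
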